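/- For every a > 0 and every ε ∈ (0, 1/2], there exists K < ∞ such that for all b ≥ K and all x ∈ [0, ε/4]: (∫_0^{(1−ε)x} y^{a−1} (1−y)^b dy) / (∫_0^1 y^{a−1} (1−y)^b dy) ≤ (∫_0^x y^{a−1} e^{−by} dy) / (∫_0^∞ y^{a−1} e^{−by} dy). -/

import Mathlib

open MeasureTheory Real Set

lemma mlr_aux (L R : ℝ → ℝ) (c : ℝ)
    (hL : IntegrableOn L (Ioc 0 c)) (hR : IntegrableOn R (Ioc 0 c))
    (hLpos : ∀ z ∈ Ioc 0 c, 0 < L z) (hRpos : ∀ z ∈ Ioc 0 c, 0 < R z)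
    (hm : ∀ z w, 0 < z → z ≤ w → w ≤ c → L z * R w ≤ L w * R z)
    (hend : ∫ z in Ioc 0 c, L z ≤ ∫ z in Ioc 0 c, R z)
    (x : ℝ) (hx : x ∈ Icc 0 c) :
    ∫ z in Ioc 0 x, L z ≤ ∫ z in Ioc 0 x, R z := by
  obtain ⟨hx0, hxc⟩ := hx
  rcases hx0.eq_or_lt with rfl | hx0
  · simp
  have s1 : Ioc 0 x ⊆ Ioc 0 c := Ioc_subset_Ioc_right hxc
  have s2 : Ioc x c ⊆ Ioc 0 c := Ioc_subset_Ioc_left hx0.le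
  rcases le_or_gt (L x) (R x) with h | h
  · refine setIntegral_mono_on (hL.mono_set s1) (hR.mono_set s1) measurableSet_Ioc ?_
    intro z hz
    have h1 := hm z x hz.1 hz.2 hxc
    have h2 := hRpos z (s1 hz)
    have h3 := hRpos x ⟨hx0, hxc⟩
    have h4 : L z * R x ≤ R z * R x := by nlinarith
    exact le_of_mul_le_mul_right h4 h3
  · have key : ∫ z in Ioc x c, R z ≤ ∫ z in Ioc x c, L z := by
      refine setIntegral_mono_on (hR.mono_set s2) (hL.mono_set s2) measurableSet_Ioc ?_
      intro z hz
      have h1 := hm x z hx0 hz.1.le hz.2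
      have h2 := hLpos z (s2 hz)
      have h3 := hLpos x ⟨hx0, hxc⟩
      have h4 : R z * L x ≤ L z * L x := by nlinarith
      exact le_of_mul_le_mul_right h4 h3
    have hd : Disjoint (Ioc 0 x) (Ioc x c) := Ioc_disjoint_Ioc_of_le le_rfl
    have hu : Ioc 0 x ∪ Ioc x c = Ioc 0 c := Ioc_union_Ioc_eq_Ioc hx0.le hxc
    have e1 := setIntegral_union hd measurableSet_Ioc (hL.mono_set s1) (hL.mono_set s2)
    have e2 := setIntegral_union hd measurableSet_Ioc (hR.mono_set s1) (hR.mono_set s2)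
    rw [hu] at e1 e2
    linarith

lemma base_ineq (ε z w : ℝ) (he : 0 < ε) (he2 : ε ≤ 1/2) (hz : 0 < z) (hzw : z ≤ w)
    (hw : w ≤ ε/4) : 1 - (1-ε)*z ≤ (1 - (1-ε)*w) * exp (w - z) := by
  have h1 := add_one_le_exp (w - z)
  have h2 : 0 ≤ 1 - (1-ε)*w := by nlinarith
  have h3 : 0 ≤ (w - z) * (ε - (1-ε)*w) := by
    apply mul_nonneg <;> nlinarith
  nlinarith [mul_le_mul_of_nonneg_left h1 h2]

lemma pow_ineq (ε z w b : ℝ) (he : 0 < ε) (he2 : ε ≤ 1/2) (hz : 0 < z) (hzw : z ≤ w)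
    (hw : w ≤ ε/4) (hb : 0 ≤ b) :
    (1 - (1-ε)*z)^b * exp (-(b*w)) ≤ (1 - (1-ε)*w)^b * exp (-(b*z)) := by
  have h := base_ineq ε z w he he2 hz hzw hw
  have h2 : 0 ≤ 1 - (1-ε)*w := by nlinarith
  have h3 : 0 ≤ 1 - (1-ε)*z := by nlinarith
  have h4 := rpow_le_rpow h3 h hb
  rw [mul_rpow h2 (exp_pos _).le, ← exp_mul] at h4
  calc _ ≤ (1 - (1-ε)*w)^b * exp ((w-z)*b) * exp (-(b*w)) := by gcongr
    _ = _ := by rw [mul_assoc, ← exp_add]; ring_nf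

lemma f_int (a b : ℝ) (ha : 0 < a) (hb : 0 ≤ b) :
    IntegrableOn (fun y : ℝ => y ^ (a - 1) * (1 - y) ^ b) (Ioc 0 1) := by
  have h1 : IntegrableOn (fun y : ℝ => y ^ (a - 1)) (Ioc 0 1) := by
    have := intervalIntegral.intervalIntegrable_rpow' (a := 0) (b := 1) (r := a - 1) (by linarith)
    rwa [intervalIntegrable_iff_integrableOn_Ioc_of_le zero_le_one] at this
  refine Integrable.mono' h1 (by fun_prop) ?_
  refine (ae_restrict_iff' measurableSet_Ioc).2 (Filter.Eventually.of_forall ?_)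
  intro y hy
  have p1 : 0 ≤ y ^ (a-1) := rpow_nonneg hy.1.le _
  have p2 : 0 ≤ (1 - y) ^ b := rpow_nonneg (by linarith [hy.2]) _
  have p3 : (1 - y) ^ b ≤ 1 := rpow_le_one (by linarith [hy.2]) (by linarith [hy.1]) hb
  rw [norm_of_nonneg (mul_nonneg p1 p2)]
  nlinarith

lemma g0_int (a : ℝ) (ha : 0 < a) :
    IntegrableOn (fun y : ℝ => y ^ (a - 1) * exp (-y)) (Ioi 0) := by
  have := Real.GammaIntegral_convergent ha
  simpa [mul_comm] using this

lemma g_int (a b : ℝ) (ha : 0 < a) (hb : 1 ≤ b) :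
    IntegrableOn (fun y : ℝ => y ^ (a - 1) * exp (-(b*y))) (Ioi 0) := by
  refine Integrable.mono' (g0_int a ha) (by fun_prop) ?_
  refine (ae_restrict_iff' measurableSet_Ioi).2 (Filter.Eventually.of_forall ?_)
  intro y hy
  have hy : 0 < y := hy
  have p1 : 0 ≤ y ^ (a-1) := rpow_nonneg hy.le _
  rw [norm_of_nonneg (mul_nonneg p1 (exp_pos _).le)]
  gcongr
  nlinarith

lemma pos_int (f : ℝ → ℝ) (s t : Set ℝ) (hs : MeasurableSet s) (hf : IntegrableOn f s)
    (ht : t ⊆ s) (hv : 0 < volume t) (h0 : ∀ y ∈ s, 0 ≤ f y) (hp : ∀ y ∈ t, 0 < f y) :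
    0 < ∫ y in s, f y := by
  rw [setIntegral_pos_iff_support_of_nonneg_ae
    ((ae_restrict_iff' hs).2 (Filter.Eventually.of_forall h0)) hf]
  refine hv.trans_le (measure_mono ?_)
  intro y hy
  exact ⟨(hp y hy).ne', ht hy⟩

lemma Z_le (a b : ℝ) (ha : 0 < a) (hb : 1 ≤ b) :
    (∫ y in Ioc (0:ℝ) 1, y ^ (a - 1) * (1 - y) ^ b) ≤
      ∫ y in Ioi (0:ℝ), y ^ (a - 1) * exp (-(b * y)) := by
  calc _ ≤ ∫ y in Ioc (0:ℝ) 1, y ^ (a - 1) * exp (-(b * y)) := by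
        refine setIntegral_mono_on (f_int a b ha (by linarith))
          ((g_int a b ha hb).mono_set Ioc_subset_Ioi_self) measurableSet_Ioc ?_
        intro y hy
        have p1 : 0 ≤ y ^ (a-1) := rpow_nonneg hy.1.le _
        have h1 : 1 - y ≤ exp (-y) := by linarith [add_one_le_exp (-y)]
        have h2 := rpow_le_rpow (by linarith [hy.2]) h1 (by linarith : 0 ≤ b)
        rw [← exp_mul] at h2
        rw [show -(b*y) = -y * b by ring]
        gcongr
    _ ≤ _ := by
        refine setIntegral_mono_set (g_int a b ha hb) ?_ (Ioc_subset_Ioi_self.eventuallyLE)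
        refine (ae_restrict_iff' measurableSet_Ioi).2 (Filter.Eventually.of_forall ?_)
        intro y hy
        exact mul_nonneg (rpow_nonneg (le_of_lt hy) _) (exp_pos _).le

lemma tail_le (a ε : ℝ) (ha : 0 < a) (he : 0 < ε) (he2 : ε ≤ 1/2) :
    ∃ K : ℝ, ∀ b : ℝ, K ≤ b → 1 ≤ b →
      (∫ y in Ioi (ε/4), y ^ (a - 1) * exp (-(b * y))) ≤
      ∫ y in Ioc ((1-ε)*(ε/4)) 1, y ^ (a - 1) * (1 - y) ^ b := by
  set c := ε/4 with hc
  set d := (1-ε/2)*c with hd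
  set c' := (1-ε)*c with hc'
  have c0 : 0 < c := by positivity
  have c'0 : 0 < c' := mul_pos (by linarith) c0
  have hcd : c' < d := by nlinarith
  have hd1 : d < 1 := by nlinarith
  have hdε : d < ε/2 := by nlinarith
  set A := ∫ y in Ioc c' d, y ^ (a-1) with hA
  set C := ∫ y in Ioi c, y ^ (a-1) * exp (-y) with hC
  have intA : IntegrableOn (fun y : ℝ => y ^ (a-1)) (Ioc c' d) := by
    have := intervalIntegral.intervalIntegrable_rpow' (a := c') (b := d) (r := a - 1) (by linarith)
    rwa [intervalIntegrable_iff_integrableOn_Ioc_of_le hcd.le] at this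
  have A0 : 0 < A := by
    refine pos_int _ _ (Ioc c' d) measurableSet_Ioc intA subset_rfl (by simp [hcd]) ?_ ?_
    · intro y hy; exact rpow_nonneg (c'0.trans hy.1).le _
    · intro y hy; exact rpow_pos_of_pos (c'0.trans hy.1) _
  have hbase : 1 < (1-d) * exp c := by
    have h1 := add_one_le_exp c
    have h2 : c * (ε/2 - d) > 0 := mul_pos c0 (by linarith)
    nlinarith [mul_le_mul_of_nonneg_left h1 (by linarith : 0 ≤ 1 - d)]
  have ht := tendsto_rpow_atTop_of_base_gt_one _ hbase
  obtain ⟨K, hK⟩ := Filter.eventually_atTop.1 (ht.eventually_ge_atTop (C * exp c / A))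
  refine ⟨K, fun b hb hb1 => ?_⟩
  have hk := hK b hb
  rw [div_le_iff₀ A0, mul_rpow (by linarith) (exp_pos _).le, ← exp_mul] at hk
  have f1 : IntegrableOn (fun y : ℝ => y ^ (a - 1) * (1 - y) ^ b) (Ioc c' 1) :=
    (f_int a b ha (by linarith)).mono_set (Ioc_subset_Ioc_left c'0.le)
  calc _ ≤ ∫ y in Ioi c, y ^ (a-1) * exp (-y) * exp (-((b-1)*c)) := by
        refine setIntegral_mono_on ((g_int a b ha hb1).mono_set (Ioi_subset_Ioi c0.le))
          (((g0_int a ha).mono_set (Ioi_subset_Ioi c0.le)).mul_const _) measurableSet_Ioi ?_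
        intro y hy
        have hy : c < y := hy
        have p1 : 0 ≤ y ^ (a-1) := rpow_nonneg (c0.trans hy).le _
        rw [mul_assoc, ← exp_add]
        gcongr
        nlinarith
    _ = C * exp c * exp (-(c*b)) := by
        rw [integral_mul_const, ← hC, mul_assoc, ← exp_add]; ring_nf
    _ ≤ (1-d)^b * exp (c*b) * A * exp (-(c*b)) := by gcongr
    _ = A * (1-d)^b := by
        have : exp (c*b) * exp (-(c*b)) = 1 := by rw [← exp_add]; simp
        linear_combination (1-d)^b * A * this
    _ = ∫ y in Ioc c' d, y ^ (a-1) * (1-d)^b := by rw [integral_mul_const]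
    _ ≤ ∫ y in Ioc c' d, y ^ (a-1) * (1-y)^b := by
        refine setIntegral_mono_on (intA.mul_const _)
          (f1.mono_set (Ioc_subset_Ioc_right hd1.le)) measurableSet_Ioc ?_
        intro y hy
        have p1 : 0 ≤ y ^ (a-1) := rpow_nonneg (c'0.trans hy.1).le _
        have := rpow_le_rpow (by linarith) (by linarith [hy.2] : 1 - d ≤ 1 - y)
          (by linarith : 0 ≤ b)
        gcongr
    _ ≤ _ := by
        refine setIntegral_mono_set f1 ?_ (Ioc_subset_Ioc_right hd1.le).eventuallyLE
        refine (ae_restrict_iff' measurableSet_Ioc).2 (Filter.Eventually.of_forall ?_)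
        intro y hy
        exact mul_nonneg (rpow_nonneg (c'0.trans hy.1).le _)
          (rpow_nonneg (by linarith [hy.2]) _)

lemma subst_int (f : ℝ → ℝ) (q x : ℝ) (hq : 0 < q) (hx : 0 ≤ x) :
    ∫ y in Ioc 0 (q*x), f y = ∫ z in Ioc 0 x, q * f (q*z) := by
  rw [← intervalIntegral.integral_of_le hx,
    ← intervalIntegral.integral_of_le (mul_nonneg hq.le hx),
    intervalIntegral.integral_const_mul, intervalIntegral.mul_integral_comp_mul_left]
  simp

/-- For every `a > 0` and every `ε ∈ (0, 1/2]`, there exists `K < ∞` such that for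
all `b ≥ K` and all `x ∈ [0, ε/4]`:
`(∫_0^((1-ε)x) y^(a-1) (1-y)^b dy) / (∫_0^1 y^(a-1) (1-y)^b dy)
  ≤ (∫_0^x y^(a-1) e^(-by) dy) / (∫_0^∞ y^(a-1) e^(-by) dy)`. -/
theorem beta_cdf_shifted_le_gamma_cdf (a : ℝ) (ha : 0 < a)
    (ε : ℝ) (hε : ε ∈ Set.Ioc (0:ℝ) (1/2)) :
    ∃ K : ℝ, ∀ b : ℝ, K ≤ b → ∀ x ∈ Set.Icc (0:ℝ) (ε/4),
      (∫ y in Set.Ioc (0:ℝ) ((1 - ε) * x), y ^ (a - 1) * (1 - y) ^ b) /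
          (∫ y in Set.Ioc (0:ℝ) 1, y ^ (a - 1) * (1 - y) ^ b) ≤
        (∫ y in Set.Ioc (0:ℝ) x, y ^ (a - 1) * Real.exp (-(b * y))) /
          (∫ y in Set.Ioi (0:ℝ), y ^ (a - 1) * Real.exp (-(b * y))) := by
  obtain ⟨he, he2⟩ := hε
  obtain ⟨K, hK⟩ := tail_le a ε ha he he2
  refine ⟨max K 1, fun b hb x hx => ?_⟩
  have hb1 : 1 ≤ b := (le_max_right _ _).trans hb
  have hb0 : 0 ≤ b := by linarith
  have htail := hK b ((le_max_left _ _).trans hb) hb1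
  have hZ := Z_le a b ha hb1
  have fi := f_int a b ha hb0
  have gi := g_int a b ha hb1
  have hq : 0 < 1 - ε := by linarith
  have c0 : 0 < ε/4 := by linarith
  have c'0 : 0 < (1-ε)*(ε/4) := mul_pos hq c0
  have c'1 : (1-ε)*(ε/4) ≤ 1 := by nlinarith
  have Zβ0 : 0 < ∫ y in Ioc (0:ℝ) 1, y ^ (a - 1) * (1 - y) ^ b := by
    refine pos_int _ _ (Ioo 0 1) measurableSet_Ioc fi Ioo_subset_Ioc_self (by simp) ?_ ?_
    · intro y hy
      exact mul_nonneg (rpow_nonneg hy.1.le _) (rpow_nonneg (by linarith [hy.2]) _)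
    · intro y hy
      exact mul_pos (rpow_pos_of_pos hy.1 _) (rpow_pos_of_pos (by linarith [hy.2]) _)
  have splitβ := setIntegral_union (Ioc_disjoint_Ioc_of_le (le_refl ((1-ε)*(ε/4))))
    measurableSet_Ioc (fi.mono_set (Ioc_subset_Ioc_right c'1))
    (fi.mono_set (Ioc_subset_Ioc_left c'0.le))
  rw [Ioc_union_Ioc_eq_Ioc c'0.le c'1] at splitβ
  have splitγ := setIntegral_union (Ioc_disjoint_Ioi (le_refl (ε/4)))
    measurableSet_Ioi (gi.mono_set Ioc_subset_Ioi_self)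
    (gi.mono_set (Ioi_subset_Ioi c0.le))
  rw [Ioc_union_Ioi_eq_Ioi c0.le] at splitγ
  have Tγ0 : 0 ≤ ∫ y in Ioi (ε/4), y ^ (a - 1) * exp (-(b * y)) := by
    refine setIntegral_nonneg measurableSet_Ioi ?_
    intro y hy
    exact mul_nonneg (rpow_nonneg (c0.trans hy).le _) (exp_pos _).le
  set Zβ := ∫ y in Ioc (0:ℝ) 1, y ^ (a - 1) * (1 - y) ^ b with hZβ
  set Zγ := ∫ y in Ioi (0:ℝ), y ^ (a - 1) * exp (-(b * y)) with hZγ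
  have Zγ0 : 0 < Zγ := Zβ0.trans_le hZ
  have conv : ∀ x, 0 ≤ x →
      (∫ y in Ioc (0:ℝ) ((1 - ε) * x), y ^ (a - 1) * (1 - y) ^ b) / Zβ =
      ∫ z in Ioc (0:ℝ) x, (1-ε) * (((1-ε)*z) ^ (a - 1) * (1 - (1-ε)*z) ^ b) / Zβ := by
    intro x hx
    rw [subst_int (fun y => y ^ (a - 1) * (1 - y) ^ b) _ _ hq hx, integral_div]
  rw [conv x hx.1, ← integral_div]
  refine mlr_aux _ _ (ε/4) ?_ ?_ ?_ ?_ ?_ ?_ x hx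
  · refine Integrable.div_const (Integrable.const_mul ?_ _) _
    have h1 := fi.mono_set (Ioc_subset_Ioc_right c'1)
    have h2 := (intervalIntegrable_iff_integrableOn_Ioc_of_le c'0.le).2 h1
    have h3 := h2.comp_mul_left (c := 1 - ε)
    rw [zero_div, mul_div_cancel_left₀ _ hq.ne'] at h3
    exact (intervalIntegrable_iff_integrableOn_Ioc_of_le c0.le).1 h3
  · exact Integrable.div_const (gi.mono_set Ioc_subset_Ioi_self) _
  · intro z hz
    have h1 : 0 < (1-ε)*z := mul_pos hq hz.1
    have h2 : 0 < 1 - (1-ε)*z := by nlinarith [hz.1, hz.2]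
    positivity
  · intro z hz
    have h1 : 0 < z := hz.1
    positivity
  · intro z w hz hzw hw
    have h := pow_ineq ε z w b he he2 hz hzw hw hb0
    have hw0 : 0 < w := hz.trans_le hzw
    rw [mul_rpow hq.le hz.le, mul_rpow hq.le hw0.le]
    have e := mul_le_mul_of_nonneg_left h
      (by positivity : 0 ≤ (1-ε) * (1-ε)^(a-1) * z^(a-1) * w^(a-1) / Zβ / Zγ)
    calc _ = _ := by ring
      _ ≤ _ := e
      _ = _ := by ring
  · rw [← conv _ c0.le, integral_div, div_le_div_iff₀ Zβ0 Zγ0]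
    nlinarith [mul_le_mul_of_nonneg_left hZ Tγ0, mul_le_mul_of_nonneg_right htail Zγ0.le]
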